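/- arXiv:1602.06235 — 3 statements merged into one kernel-verified Lean document; each statement's English description precedes it below -/
import Mathlib

section
/- Let P₁, …, P_L be jointly irreducible probability distributions, let η₁, …, η_L ∈ Δ_L be linearly independent, and let Q_i = ∑_{k=1}^L η_{i,k} P_k for i = 1, …, L. Then for every i ∈ {1, …, L} and every nonempty A ⊆ {1, …, L} \ {i}: κ*(Q_i | {Q_j : j ∈ A}) = κ*(η_i | {η_j : j ∈ A}) < 1, where on the right-hand side the elements of Δ_L are regarded as probability distributions on {1, …, L}; moreover, γ ∈ Δ_L is a multi-sample residue of η_i with respect to {η_j : j ∈ A} if and only if G = ∑_{k=1}^L γ_k P_k is a multi-sample residue of Q_i with respect to {Q_j : j ∈ A}. -/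
open MeasureTheory

/-- Probability distributions `P₁, …, P_L` are *jointly irreducible* if whenever a real linear
combination `∑ γᵢ Pᵢ` (in the space of finite signed measures) is a probability distribution,
all coefficients `γᵢ` are nonnegative. -/
def JointlyIrreducible {X : Type*} [MeasurableSpace X] {L : ℕ}
    (P : Fin L → Measure X) [∀ j, IsProbabilityMeasure (P j)] : Prop :=
  ∀ (γ : Fin L → ℝ) (Q : Measure X) (_ : IsProbabilityMeasure Q),
    Q.toSignedMeasure = ∑ i, γ i • (P i).toSignedMeasure → ∀ i, 0 ≤ γ i

/-- Multi-sample `κ*(F₀ | {F j : j ∈ A})` for probability measures. -/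
noncomputable def kappaMultiMeas {X : Type*} [MeasurableSpace X] {L : ℕ}
    (F₀ : Measure X) [IsFiniteMeasure F₀] (F : Fin L → Measure X)
    [∀ j, IsProbabilityMeasure (F j)] (A : Finset (Fin L)) : ℝ :=
  sSup {s : ℝ | ∃ ν : Fin L → ℝ, (∀ j ∈ A, 0 ≤ ν j) ∧ (∑ j ∈ A, ν j) ≤ 1 ∧
    s = ∑ j ∈ A, ν j ∧
    ∃ (G : Measure X) (_ : IsProbabilityMeasure G),
      F₀.toSignedMeasure = (1 - ∑ j ∈ A, ν j) • G.toSignedMeasure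
        + ∑ j ∈ A, ν j • (F j).toSignedMeasure}

/-- `G` is a multi-sample residue of `F₀` with respect to `{F j : j ∈ A}`: it is a probability
distribution attaining the supremum defining `κ*(F₀ | {F j : j ∈ A})`. -/
def IsMultiResidueMeas {X : Type*} [MeasurableSpace X] {L : ℕ}
    (F₀ : Measure X) [IsFiniteMeasure F₀] (F : Fin L → Measure X)
    [∀ j, IsProbabilityMeasure (F j)] (A : Finset (Fin L)) (G : Measure X) : Prop :=
  ∃ (_ : IsProbabilityMeasure G) (ν : Fin L → ℝ),
    (∀ j ∈ A, 0 ≤ ν j) ∧ (∑ j ∈ A, ν j) ≤ 1 ∧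
    (∑ j ∈ A, ν j) = kappaMultiMeas F₀ F A ∧
    F₀.toSignedMeasure = (1 - ∑ j ∈ A, ν j) • G.toSignedMeasure
      + ∑ j ∈ A, ν j • (F j).toSignedMeasure

/-- Multi-sample `κ*(η₀ | {η j : j ∈ A})` for elements of the simplex `Δ_L`, regarded as
probability distributions on `{1, …, L}`. -/
noncomputable def kappaMultiVec {L : ℕ} (η₀ : Fin L → ℝ) (η : Fin L → Fin L → ℝ)
    (A : Finset (Fin L)) : ℝ :=
  sSup {s : ℝ | ∃ ν : Fin L → ℝ, (∀ j ∈ A, 0 ≤ ν j) ∧ (∑ j ∈ A, ν j) ≤ 1 ∧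
    s = ∑ j ∈ A, ν j ∧
    ∃ g ∈ stdSimplex ℝ (Fin L),
      η₀ = (1 - ∑ j ∈ A, ν j) • g + ∑ j ∈ A, ν j • η j}

/-- `γ ∈ Δ_L` is a multi-sample residue of `η₀` with respect to `{η j : j ∈ A}`. -/
def IsMultiResidueVec {L : ℕ} (η₀ : Fin L → ℝ) (η : Fin L → Fin L → ℝ)
    (A : Finset (Fin L)) (γ : Fin L → ℝ) : Prop :=
  γ ∈ stdSimplex ℝ (Fin L) ∧ ∃ ν : Fin L → ℝ,
    (∀ j ∈ A, 0 ≤ ν j) ∧ (∑ j ∈ A, ν j) ≤ 1 ∧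
    (∑ j ∈ A, ν j) = kappaMultiVec η₀ η A ∧
    η₀ = (1 - ∑ j ∈ A, ν j) • γ + ∑ j ∈ A, ν j • η j

/-- A jointly irreducible family of probability measures is linearly independent. -/
theorem JointlyIrreducible.linearIndependent {X : Type*} [MeasurableSpace X] {L : ℕ}
    {P : Fin L → Measure X} [∀ j, IsProbabilityMeasure (P j)] (hJI : JointlyIrreducible P) :
    LinearIndependent ℝ fun k => (P k).toSignedMeasure := by
  rw [Fintype.linearIndependent_iff]
  intro γ hγ j
  by_contra hj
  have h := hJI (Pi.single j 1 + (-2 / γ j) • γ) (P j) inferInstance (by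
    simp [add_smul, Finset.sum_add_distrib, mul_smul, ← Finset.smul_sum, hγ, Pi.single_apply,
      ite_smul]) j
  simp [hj] at h

/-- The weights of a linear combination of probability measures that is a probability measure
sum to one. -/
theorem sum_eq_one_of_toSignedMeasure_eq {X : Type*} [MeasurableSpace X] {L : ℕ}
    {P : Fin L → Measure X} [∀ j, IsProbabilityMeasure (P j)] {γ : Fin L → ℝ}
    {G : Measure X} [IsProbabilityMeasure G]
    (hG : G.toSignedMeasure = ∑ k, γ k • (P k).toSignedMeasure) : ∑ k, γ k = 1 := by
  have h := congrArg (fun μ : SignedMeasure X => μ Set.univ) hG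
  simpa [Measure.toSignedMeasure_apply_measurable] using h.symm

/-- A convex combination of probability measures is a probability measure. -/
theorem exists_isProbabilityMeasure_toSignedMeasure_eq {X : Type*} [MeasurableSpace X] {L : ℕ}
    (P : Fin L → Measure X) [∀ j, IsProbabilityMeasure (P j)] {γ : Fin L → ℝ}
    (hγ : γ ∈ stdSimplex ℝ (Fin L)) :
    ∃ (G : Measure X) (_ : IsProbabilityMeasure G),
      G.toSignedMeasure = ∑ k, γ k • (P k).toSignedMeasure := by
  have hprob : IsProbabilityMeasure (∑ k, ENNReal.ofReal (γ k) • P k) := by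
    constructor
    simp [← ENNReal.ofReal_sum_of_nonneg fun k _ => hγ.1 k, hγ.2]
  refine ⟨_, hprob, ?_⟩
  ext s hs
  rw [Measure.toSignedMeasure_apply_measurable hs, measureReal_def, Measure.finsetSum_apply,
    ENNReal.toReal_sum fun k _ => by simp [ENNReal.mul_eq_top]]
  simp [Measure.toSignedMeasure_apply_measurable hs, measureReal_def,
    ENNReal.toReal_ofReal (hγ.1 _)]

/-- For linearly independent `η`, the total mass that `η j`, `j ∈ A`, can take in a mixture
decomposition of `η i` is bounded away from one. -/
theorem exists_lt_one_forall_sum_le {L : ℕ} {η : Fin L → Fin L → ℝ}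
    (hind : LinearIndependent ℝ η) {i : Fin L} {A : Finset (Fin L)} (hiA : i ∉ A) :
    ∃ c < (1 : ℝ), ∀ ν : Fin L → ℝ, (∑ j ∈ A, ν j) ≤ 1 → ∀ g ∈ stdSimplex ℝ (Fin L),
      η i = (1 - ∑ j ∈ A, ν j) • g + ∑ j ∈ A, ν j • η j → ∑ j ∈ A, ν j ≤ c := by
  have : Nonempty (Fin L) := ⟨i⟩
  let b := basisOfLinearIndependentOfCardEqFinrank hind (by simp)
  have hb : ∀ j, b j = η j := fun j => by simp [b]
  set φ := b.coord i
  have hφi : φ (η i) = 1 := by simp [φ, ← hb]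
  have hφ : ∀ j ∈ A, φ (η j) = 0 := fun j hj => by
    have : j ≠ i := fun h => hiA (h ▸ hj)
    simp [φ, ← hb, this]
  set M := 1 + ∑ k, |φ (Pi.single k 1)|
  have hM : 0 < M := by positivity
  refine ⟨1 - 1 / M, by simp [hM], fun ν hν g hg h => ?_⟩
  have hgM : φ g ≤ M := by
    have hle : φ g ≤ ∑ k, |φ (Pi.single k 1)| := by
      rw [LinearMap.pi_apply_eq_sum_univ φ g]
      refine Finset.sum_le_sum fun k _ => ?_
      have hk : (fun j => if k = j then (1 : ℝ) else 0) = Pi.single k 1 := by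
        ext j; simp [Pi.single_apply, eq_comm]
      rw [hk, smul_eq_mul]
      have h1 : g k ≤ 1 := (mem_Icc_of_mem_stdSimplex hg k).2
      nlinarith [le_abs_self (φ (Pi.single k 1)), abs_nonneg (φ (Pi.single k 1)), hg.1 k]
    simp only [M]
    linarith
  have h1 : 1 = (1 - ∑ j ∈ A, ν j) * φ g := by
    have h2 := congrArg φ h
    have h0 : ∑ j ∈ A, φ (ν j • η j) = 0 :=
      Finset.sum_eq_zero fun j hj => by rw [map_smul, hφ j hj, smul_zero]
    rw [hφi, map_add, map_sum, h0] at h2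
    simpa only [add_zero, map_smul, smul_eq_mul] using h2
  have h3 : 1 / M ≤ 1 - ∑ j ∈ A, ν j := by
    rw [div_le_iff₀ hM]
    nlinarith
  linarith

/-- Mixture decompositions of combinations of linearly independent measures correspond to
mixture decompositions of the coefficient vectors. -/
theorem toSignedMeasure_eq_mixture_iff {X : Type*} [MeasurableSpace X] {L : ℕ}
    {P : Fin L → Measure X} [∀ j, IsProbabilityMeasure (P j)]
    (hP : LinearIndependent ℝ fun k => (P k).toSignedMeasure)
    {η : Fin L → Fin L → ℝ} {Q : Fin L → Measure X} [∀ i, IsProbabilityMeasure (Q i)]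
    (hQ : ∀ i, (Q i).toSignedMeasure = ∑ k, η i k • (P k).toSignedMeasure)
    {γ : Fin L → ℝ} {G : Measure X} [IsProbabilityMeasure G]
    (hG : G.toSignedMeasure = ∑ k, γ k • (P k).toSignedMeasure)
    (i : Fin L) (A : Finset (Fin L)) (ν : Fin L → ℝ) (c : ℝ) :
    (Q i).toSignedMeasure = c • G.toSignedMeasure + ∑ j ∈ A, ν j • (Q j).toSignedMeasure ↔
      η i = c • γ + ∑ j ∈ A, ν j • η j := by
  rw [← (linearIndependent_iff_injective_fintypeLinearCombination.mp hP).eq_iff]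
  simp only [map_add, map_sum, map_smul, Fintype.linearCombination_apply, ← hQ, ← hG]

/-- Under joint irreducibility, every residual distribution in a mixture decomposition of `Q i`
is itself a convex combination of the `P k`. -/
theorem JointlyIrreducible.exists_mem_stdSimplex {X : Type*} [MeasurableSpace X] {L : ℕ}
    {P : Fin L → Measure X} [∀ j, IsProbabilityMeasure (P j)] (hJI : JointlyIrreducible P)
    {η : Fin L → Fin L → ℝ} (hind : LinearIndependent ℝ η)
    {Q : Fin L → Measure X} [∀ i, IsProbabilityMeasure (Q i)]
    (hQ : ∀ i, (Q i).toSignedMeasure = ∑ k, η i k • (P k).toSignedMeasure)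
    {i : Fin L} {A : Finset (Fin L)} (hiA : i ∉ A) {ν : Fin L → ℝ} {c : ℝ}
    {G : Measure X} [IsProbabilityMeasure G]
    (h : (Q i).toSignedMeasure = c • G.toSignedMeasure + ∑ j ∈ A, ν j • (Q j).toSignedMeasure) :
    ∃ γ ∈ stdSimplex ℝ (Fin L), G.toSignedMeasure = ∑ k, γ k • (P k).toSignedMeasure := by
  have hc : c ≠ 0 := by
    rintro rfl
    have h' : (Q i).toSignedMeasure =
        (0 : ℝ) • (Q i).toSignedMeasure + ∑ j ∈ A, ν j • (Q j).toSignedMeasure := by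
      simpa using h
    rw [toSignedMeasure_eq_mixture_iff hJI.linearIndependent hQ (hQ i), zero_smul, zero_add] at h'
    refine hind.notMem_span_image (s := (A : Set (Fin L))) (x := i) (by simpa using hiA) ?_
    rw [h']
    exact Submodule.sum_mem _ fun j hj =>
      Submodule.smul_mem _ _ (Submodule.subset_span ⟨j, hj, rfl⟩)
  have hG : G.toSignedMeasure =
      ∑ k, (c⁻¹ • (η i - ∑ j ∈ A, ν j • η j)) k • (P k).toSignedMeasure := by
    rw [← Fintype.linearCombination_apply]
    simp only [map_sub, map_sum, map_smul, Fintype.linearCombination_apply, ← hQ]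
    rw [h, add_sub_cancel_right, inv_smul_smul₀ hc]
  exact ⟨_, ⟨hJI _ G inferInstance hG, sum_eq_one_of_toSignedMeasure_eq hG⟩, hG⟩

/-- The two notions of `κ*` agree under joint irreducibility. -/
theorem JointlyIrreducible.kappaMultiMeas_eq {X : Type*} [MeasurableSpace X] {L : ℕ}
    {P : Fin L → Measure X} [∀ j, IsProbabilityMeasure (P j)] (hJI : JointlyIrreducible P)
    {η : Fin L → Fin L → ℝ} (hind : LinearIndependent ℝ η)
    {Q : Fin L → Measure X} [∀ i, IsProbabilityMeasure (Q i)]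
    (hQ : ∀ i, (Q i).toSignedMeasure = ∑ k, η i k • (P k).toSignedMeasure)
    {i : Fin L} {A : Finset (Fin L)} (hiA : i ∉ A) :
    kappaMultiMeas (Q i) Q A = kappaMultiVec (η i) η A := by
  have hP := hJI.linearIndependent
  unfold kappaMultiMeas kappaMultiVec
  congr 1
  ext s
  refine exists_congr fun ν => and_congr_right fun _ => and_congr_right fun _ =>
    and_congr_right fun _ => ⟨?_, ?_⟩
  · rintro ⟨G, hG, h⟩
    obtain ⟨γ, hγ, hGγ⟩ := hJI.exists_mem_stdSimplex hind hQ hiA h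
    exact ⟨γ, hγ, (toSignedMeasure_eq_mixture_iff hP hQ hGγ i A ν _).mp h⟩
  · rintro ⟨γ, hγ, h⟩
    obtain ⟨G, hG, hGγ⟩ := exists_isProbabilityMeasure_toSignedMeasure_eq P hγ
    exact ⟨G, hG, (toSignedMeasure_eq_mixture_iff hP hQ hGγ i A ν _).mpr h⟩

theorem kappaMultiVec_lt_one {L : ℕ} {η : Fin L → Fin L → ℝ}
    (hind : LinearIndependent ℝ η) {i : Fin L} (hη : η i ∈ stdSimplex ℝ (Fin L))
    {A : Finset (Fin L)} (hiA : i ∉ A) : kappaMultiVec (η i) η A < 1 := by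
  obtain ⟨c, hc, hle⟩ := exists_lt_one_forall_sum_le hind hiA
  refine lt_of_le_of_lt (csSup_le ⟨0, 0, by simp, by simp, by simp, η i, hη, by simp⟩ ?_) hc
  rintro _ ⟨ν, -, hν, rfl, g, hg, h⟩
  exact hle ν hν g hg h

/-- For jointly irreducible `P₁, …, P_L`, linearly independent
`η₁, …, η_L ∈ Δ_L` and `Q i = ∑ₖ η i k • P k`: for every `i` and nonempty `A ⊆ [L] \ {i}`,
`κ*(Q i | {Q j : j ∈ A}) = κ*(η i | {η j : j ∈ A}) < 1`, and `γ ∈ Δ_L` is a multi-sample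
residue of `η i` iff `G = ∑ₖ γ k • P k` is a multi-sample residue of `Q i`. -/
theorem stmt5 {X : Type*} [MeasurableSpace X] {L : ℕ}
    (P : Fin L → Measure X) [∀ j, IsProbabilityMeasure (P j)]
    (hJI : JointlyIrreducible P)
    (η : Fin L → Fin L → ℝ) (hη : ∀ i, η i ∈ stdSimplex ℝ (Fin L))
    (hind : LinearIndependent ℝ η)
    (Q : Fin L → Measure X) [∀ i, IsProbabilityMeasure (Q i)]
    (hQ : ∀ i, (Q i).toSignedMeasure = ∑ k, η i k • (P k).toSignedMeasure)
    (i : Fin L) (A : Finset (Fin L)) (hA : A.Nonempty) (hiA : i ∉ A) :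
    kappaMultiMeas (Q i) Q A = kappaMultiVec (η i) η A ∧
    kappaMultiMeas (Q i) Q A < 1 ∧
    ∀ γ ∈ stdSimplex ℝ (Fin L),
      (IsMultiResidueVec (η i) η A γ ↔
        ∃ (G : Measure X) (_ : IsProbabilityMeasure G),
          G.toSignedMeasure = ∑ k, γ k • (P k).toSignedMeasure ∧
          IsMultiResidueMeas (Q i) Q A G) := by
  have hP := hJI.linearIndependent
  have hκ := hJI.kappaMultiMeas_eq hind hQ hiA
  refine ⟨hκ, hκ ▸ kappaMultiVec_lt_one hind (hη i) hiA, fun γ hγ => ⟨?_, ?_⟩⟩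
  · rintro ⟨-, ν, hν, hν1, hsum, h⟩
    obtain ⟨G, hG, hGγ⟩ := exists_isProbabilityMeasure_toSignedMeasure_eq P hγ
    exact ⟨G, hG, hGγ, hG, ν, hν, hν1, hsum.trans hκ.symm,
      (toSignedMeasure_eq_mixture_iff hP hQ hGγ i A ν _).mpr h⟩
  · rintro ⟨G, hG, hGγ, _, ν, hν, hν1, hsum, h⟩
    exact ⟨hγ, ν, hν, hν1, hsum.trans hκ,
      (toSignedMeasure_eq_mixture_iff hP hQ hGγ i A ν _).mp h⟩
end

section
/- Let η₁, η₂, η₃ ∈ Δ_L be distinct, let (α_n) be a sequence in [0,1] with α_n → 1, and assume α_n η₂ + (1−α_n) η₃ ≠ η₁ for every n. Let μ ∈ Δ_L be the residue of η₂ with respect to η₁, and let τ_n ∈ Δ_L be the residue of α_n η₂ + (1−α_n) η₃ with respect to η₁ (elements of Δ_L being regarded as probability distributions on {1, …, L}, so that these residues exist and are unique). Then ‖τ_n − μ‖ → 0 as n → ∞. -/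
open Filter

/-- The two-sample operator `κ*(a | b)` for elements of the simplex `Δ_L`, regarded as
probability distributions on `{1, …, L}`:
`κ*(a | b) = sup {κ ∈ [0,1] : ∃ g ∈ Δ_L, a = (1−κ)g + κb}`. -/
noncomputable def kappaTwoVec {L : ℕ} (a b : Fin L → ℝ) : ℝ :=
  sSup {κ : ℝ | κ ∈ Set.Icc (0 : ℝ) 1 ∧ ∃ g ∈ stdSimplex ℝ (Fin L),
    a = (1 - κ) • g + κ • b}

/-- The support of a point of the simplex is nonempty. -/
lemma support_nonempty_of_mem_stdSimplex {L : ℕ} {b : Fin L → ℝ}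
    (hb : b ∈ stdSimplex ℝ (Fin L)) : (Finset.univ.filter fun i => 0 < b i).Nonempty := by
  by_contra h
  rw [Finset.not_nonempty_iff_eq_empty, Finset.filter_eq_empty_iff] at h
  have hsum : ∑ i, b i = 0 :=
    Finset.sum_eq_zero fun i hi => le_antisymm (not_lt.mp (h hi)) (hb.1 i)
  linarith [hb.2]

/-- On the simplex, `κ*(a | b)` is the least likelihood ratio `a i / b i` over the support of `b`,
and it is less than `1` when `a ≠ b`. -/
lemma kappaTwoVec_eq_inf' {L : ℕ} {a b : Fin L → ℝ} (ha : a ∈ stdSimplex ℝ (Fin L))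
    (hb : b ∈ stdSimplex ℝ (Fin L)) (hab : a ≠ b) :
    kappaTwoVec a b = (Finset.univ.filter fun i => 0 < b i).inf'
      (support_nonempty_of_mem_stdSimplex hb) (fun i => a i / b i) ∧ kappaTwoVec a b < 1 := by
  set c := (Finset.univ.filter fun i => 0 < b i).inf'
    (support_nonempty_of_mem_stdSimplex hb) (fun i => a i / b i) with hc
  have hle (i : Fin L) : c * b i ≤ a i := by
    rcases (hb.1 i).eq_or_lt with h | h
    · rw [← h, mul_zero]
      exact ha.1 i
    · rw [← le_div_iff₀ h]
      exact Finset.inf'_le _ (by simpa using h)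
  have hc0 : 0 ≤ c := (Finset.le_inf'_iff _ _).mpr fun i _ => div_nonneg (ha.1 i) (hb.1 i)
  have hc1 : c < 1 := by
    by_contra! h
    have hba : ∀ i ∈ Finset.univ, b i ≤ a i := fun i _ =>
      (le_mul_of_one_le_left (hb.1 i) h).trans (hle i)
    have heq := (Finset.sum_eq_sum_iff_of_le hba).mp (hb.2.trans ha.2.symm)
    exact hab (funext fun i => (heq i (Finset.mem_univ i)).symm)
  have hpos : 0 < 1 - c := sub_pos.mpr hc1
  have hgreatest : IsGreatest {κ : ℝ | κ ∈ Set.Icc (0 : ℝ) 1 ∧ ∃ g ∈ stdSimplex ℝ (Fin L),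
      a = (1 - κ) • g + κ • b} c := by
    refine ⟨⟨⟨hc0, hc1.le⟩, (1 - c)⁻¹ • (a - c • b), ⟨fun i => ?_, ?_⟩, ?_⟩, ?_⟩
    · simpa using mul_nonneg (inv_nonneg.mpr hpos.le) (sub_nonneg.mpr (hle i))
    · simp only [Pi.smul_apply, Pi.sub_apply, smul_eq_mul, ← Finset.mul_sum,
        Finset.sum_sub_distrib, ha.2, hb.2, mul_one]
      exact inv_mul_cancel₀ hpos.ne'
    · rw [smul_inv_smul₀ hpos.ne', sub_add_cancel]
    · rintro κ ⟨hκ, g, hg, rfl⟩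
      refine (Finset.le_inf'_iff _ _).mpr fun i hi => ?_
      rw [le_div_iff₀ (by simpa using hi)]
      simpa using mul_nonneg (sub_nonneg.mpr hκ.2) (hg.1 i)
  have hκ : kappaTwoVec a b = c := hgreatest.csSup_eq
  exact ⟨hκ, hκ ▸ hc1⟩

/-- `κ*(a n | b) → κ*(a | b)` when `a n → a` in the simplex, away from `b`. -/
lemma tendsto_kappaTwoVec {L : ℕ} {a : ℕ → Fin L → ℝ} {a₀ b : Fin L → ℝ}
    (ha : ∀ n, a n ∈ stdSimplex ℝ (Fin L)) (ha₀ : a₀ ∈ stdSimplex ℝ (Fin L))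
    (hb : b ∈ stdSimplex ℝ (Fin L)) (hab : ∀ n, a n ≠ b) (hab₀ : a₀ ≠ b)
    (h : Tendsto a atTop (nhds a₀)) :
    Tendsto (fun n => kappaTwoVec (a n) b) atTop (nhds (kappaTwoVec a₀ b)) := by
  simp only [(kappaTwoVec_eq_inf' ha₀ hb hab₀).1, fun n => (kappaTwoVec_eq_inf' (ha n) hb (hab n)).1]
  have hcont : Continuous fun x : Fin L → ℝ => (Finset.univ.filter fun i => 0 < b i).inf'
      (support_nonempty_of_mem_stdSimplex hb) (fun i => x i / b i) :=
    Continuous.finset_inf'_apply _ fun i _ => (continuous_apply i).div_const _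
  exact (hcont.tendsto a₀).comp h

/-- A residue is recovered from the mixture and its weight. -/
lemma eq_inv_smul_of_eq_mixture {L : ℕ} {a b g : Fin L → ℝ} {κ : ℝ} (hκ : κ < 1)
    (h : a = (1 - κ) • g + κ • b) : g = (1 - κ)⁻¹ • (a - κ • b) := by
  rw [h, add_sub_cancel_right, inv_smul_smul₀ (sub_pos.mpr hκ).ne']

/-- Let `η₁, η₂, η₃ ∈ Δ_L` be distinct, `α_n ∈ [0,1]` with `α_n → 1` and
`α_n η₂ + (1−α_n) η₃ ≠ η₁` for all `n`. If `μ` is the residue of `η₂` with respect to `η₁`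
and `τ_n` is the residue of `α_n η₂ + (1−α_n) η₃` with respect to `η₁`, then
`‖τ_n − μ‖ → 0`. -/
theorem stmt10 {L : ℕ} (η₁ η₂ η₃ : Fin L → ℝ)
    (hη₁ : η₁ ∈ stdSimplex ℝ (Fin L)) (hη₂ : η₂ ∈ stdSimplex ℝ (Fin L))
    (hη₃ : η₃ ∈ stdSimplex ℝ (Fin L))
    (h12 : η₁ ≠ η₂) (h13 : η₁ ≠ η₃) (h23 : η₂ ≠ η₃)
    (α : ℕ → ℝ) (hα : ∀ n, α n ∈ Set.Icc (0 : ℝ) 1)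
    (hαlim : Tendsto α atTop (nhds 1))
    (hne : ∀ n, α n • η₂ + (1 - α n) • η₃ ≠ η₁)
    (μ : Fin L → ℝ) (hμΔ : μ ∈ stdSimplex ℝ (Fin L))
    (hμ : η₂ = (1 - kappaTwoVec η₂ η₁) • μ + kappaTwoVec η₂ η₁ • η₁)
    (τ : ℕ → Fin L → ℝ) (hτΔ : ∀ n, τ n ∈ stdSimplex ℝ (Fin L))
    (hτ : ∀ n, α n • η₂ + (1 - α n) • η₃
      = (1 - kappaTwoVec (α n • η₂ + (1 - α n) • η₃) η₁) • τ n
        + kappaTwoVec (α n • η₂ + (1 - α n) • η₃) η₁ • η₁) :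
    Tendsto (fun n => ‖τ n - μ‖) atTop (nhds 0) := by
  have hmem (n : ℕ) : α n • η₂ + (1 - α n) • η₃ ∈ stdSimplex ℝ (Fin L) :=
    convex_stdSimplex ℝ (Fin L) hη₂ hη₃ (hα n).1 (sub_nonneg.mpr (hα n).2) (by ring)
  have hlim : Tendsto (fun n => α n • η₂ + (1 - α n) • η₃) atTop (nhds η₂) := by
    simpa using (hαlim.smul_const η₂).add ((hαlim.const_sub 1).smul_const η₃)
  have hκlim := tendsto_kappaTwoVec hmem hη₂ hη₁ hne h12.symm hlim
  have hκ := (kappaTwoVec_eq_inf' hη₂ hη₁ h12.symm).2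
  rw [← tendsto_iff_norm_sub_tendsto_zero, eq_inv_smul_of_eq_mixture hκ hμ,
    funext fun n => eq_inv_smul_of_eq_mixture (kappaTwoVec_eq_inf' (hmem n) hη₁ (hne n)).2 (hτ n)]
  exact ((hκlim.const_sub 1).inv₀ (sub_pos.mpr hκ).ne').smul (hlim.sub (hκlim.smul_const η₁))
end

section
/- Let X be a topological space equipped with its Borel σ-algebra and let P₁, …, P_L be probability measures on X satisfying: for every i, supp(P_i) ⊄ ∪_{j≠i} supp(P_j). Let F, H ∈ co(P₁, …, P_L) with F ≠ H. Then there exist a probability distribution G and γ ∈ [0,1] such that F = (1−γ)G + γH and supp(H) ⊄ supp(G). -/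
open MeasureTheory

/-- The topological support of a measure: the set of points all of whose open neighborhoods
have positive measure. -/
def measureSupport {X : Type*} [TopologicalSpace X] [MeasurableSpace X] (F : Measure X) :
    Set X :=
  {x | ∀ U : Set X, IsOpen U → x ∈ U → 0 < F U}

/-- A point of the convex hull of a finite family is a convex combination of its members. -/
lemma exists_weights_of_mem_convexHull_range {E ι : Type*} [AddCommGroup E] [Module ℝ E]
    [Fintype ι] {v : ι → E} {x : E} (hx : x ∈ convexHull ℝ (Set.range v)) :
    ∃ w : ι → ℝ, (∀ i, 0 ≤ w i) ∧ ∑ i, w i = 1 ∧ x = ∑ i, w i • v i := by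
  classical
  let K := (fun w : ι → ℝ => ∑ i, w i • v i) '' stdSimplex ℝ ι
  have hK : Convex ℝ K :=
    (convex_stdSimplex ℝ ι).is_linear_image
      ⟨fun a b => by simp [add_smul, Finset.sum_add_distrib],
        fun c a => by simp [mul_smul, Finset.smul_sum]⟩
  have hsub : Set.range v ⊆ K := by
    rintro _ ⟨i, rfl⟩
    exact ⟨Pi.single i 1, single_mem_stdSimplex ℝ i, by simp [Pi.single_apply]⟩
  obtain ⟨w, hw, rfl⟩ := convexHull_min hsub hK hx
  exact ⟨w, hw.1, hw.2, rfl⟩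

/-- Of two distinct points of the standard simplex, the first is a mixture of the second and
of a point vanishing at some coordinate where the second does not vanish. -/
lemma exists_residual_weights {ι : Type*} [Fintype ι] {f h : ι → ℝ}
    (hf0 : ∀ i, 0 ≤ f i) (hf1 : ∑ i, f i = 1) (hh0 : ∀ i, 0 ≤ h i) (hh1 : ∑ i, h i = 1)
    (hne : f ≠ h) :
    ∃ (g : ι → ℝ) (γ : ℝ) (i : ι), (∀ j, 0 ≤ g j) ∧ ∑ j, g j = 1 ∧ γ ∈ Set.Icc (0 : ℝ) 1 ∧
      (∀ j, f j = (1 - γ) * g j + γ * h j) ∧ g i = 0 ∧ 0 < h i := by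
  classical
  have hpos : (Finset.univ.filter fun i => 0 < h i).Nonempty := by
    obtain ⟨i, hi, hi'⟩ := Finset.exists_ne_zero_of_sum_ne_zero (hh1.trans_ne one_ne_zero)
    exact ⟨i, by simpa using (hh0 i).lt_of_ne' hi'⟩
  obtain ⟨i, hi, hmin⟩ := Finset.exists_min_image _ (fun i => f i / h i) hpos
  have hi : 0 < h i := by simpa using hi
  set γ := f i / h i with hγ
  have hγ0 : 0 ≤ γ := div_nonneg (hf0 i) hi.le
  have hle : ∀ j, γ * h j ≤ f j := by
    intro j
    rcases (hh0 j).eq_or_lt with hj | hj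
    · simpa [← hj] using hf0 j
    · exact (le_div_iff₀ hj).1 (hmin j (by simpa using hj))
  have hγ1 : γ < 1 := by
    by_contra! hcon
    have hle' : ∀ j, h j ≤ f j := fun j => by nlinarith [hle j, hh0 j]
    refine hne (funext fun j => ?_)
    exact ((Finset.sum_eq_sum_iff_of_le fun j _ => hle' j).1 (hh1.trans hf1.symm) j
      (Finset.mem_univ j)).symm
  have hγ' : 0 < 1 - γ := sub_pos.2 hγ1
  refine ⟨fun j => (f j - γ * h j) / (1 - γ), γ, i,
    fun j => div_nonneg (sub_nonneg.2 (hle j)) hγ'.le, ?_, ⟨hγ0, hγ1.le⟩, fun j => ?_, ?_, hi⟩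
  · rw [← Finset.sum_div, Finset.sum_sub_distrib, ← Finset.mul_sum, hf1, hh1, mul_one,
      div_self hγ'.ne']
  · field_simp
    ring
  · simp [hγ, div_mul_cancel₀ _ hi.ne']

/-- Convex combinations of probability measures are probability measures. -/
lemma exists_isProbabilityMeasure_toSignedMeasure_eq_sum {X ι : Type*} [MeasurableSpace X]
    [Fintype ι] (P : ι → Measure X) [∀ i, IsProbabilityMeasure (P i)] {w : ι → ℝ}
    (hw0 : ∀ i, 0 ≤ w i) (hw1 : ∑ i, w i = 1) :
    ∃ (G : Measure X) (_ : IsProbabilityMeasure G),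
      G.toSignedMeasure = ∑ i, w i • (P i).toSignedMeasure := by
  have hG : IsProbabilityMeasure (∑ i, ENNReal.ofReal (w i) • P i) :=
    ⟨by simp [← ENNReal.ofReal_sum_of_nonneg fun i _ => hw0 i, hw1]⟩
  refine ⟨_, hG, ?_⟩
  ext A hA
  rw [Measure.toSignedMeasure_apply_measurable hA, measureReal_def]
  simp only [Measure.finsetSum_apply, Measure.smul_apply, smul_eq_mul]
  rw [ENNReal.toReal_sum fun i _ =>
    ENNReal.mul_ne_top ENNReal.ofReal_ne_top (measure_ne_top _ _)]
  simp [hw0, hA, measureReal_def]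

lemma measureReal_eq_sum_of_toSignedMeasure_eq {X ι : Type*} [MeasurableSpace X]
    [Fintype ι] {P : ι → Measure X} [∀ i, IsFiniteMeasure (P i)] {w : ι → ℝ}
    {G : Measure X} [IsFiniteMeasure G]
    (hG : G.toSignedMeasure = ∑ i, w i • (P i).toSignedMeasure) {A : Set X}
    (hA : MeasurableSet A) : G.real A = ∑ i, w i * (P i).real A := by
  rw [← Measure.toSignedMeasure_apply_measurable hA, hG]
  simp [hA]

/-- Let `P₁, …, P_L` be probability measures on a topological space with its
Borel σ-algebra such that no `supp(P i)` is contained in `⋃_{j ≠ i} supp(P j)`. Then for any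
`F ≠ H` in `co(P₁, …, P_L)` there are a probability distribution `G` and `γ ∈ [0,1]` with
`F = (1−γ)G + γH` and `supp(H) ⊄ supp(G)`. -/
theorem stmt18 {X : Type*} [TopologicalSpace X] [MeasurableSpace X] [BorelSpace X] {L : ℕ}
    (P : Fin L → Measure X) [∀ j, IsProbabilityMeasure (P j)]
    (hsupp : ∀ i, ¬ measureSupport (P i) ⊆ ⋃ j ∈ ({i}ᶜ : Set (Fin L)), measureSupport (P j))
    (F H : Measure X) [IsProbabilityMeasure F] [IsProbabilityMeasure H]
    (hF : F.toSignedMeasure ∈ convexHull ℝ (Set.range fun j => (P j).toSignedMeasure))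
    (hH : H.toSignedMeasure ∈ convexHull ℝ (Set.range fun j => (P j).toSignedMeasure))
    (hFH : F ≠ H) :
    ∃ (G : Measure X) (_ : IsProbabilityMeasure G) (γ : ℝ), γ ∈ Set.Icc (0 : ℝ) 1 ∧
      F.toSignedMeasure = (1 - γ) • G.toSignedMeasure + γ • H.toSignedMeasure ∧
      ¬ measureSupport H ⊆ measureSupport G := by
  obtain ⟨f, hf0, hf1, hf⟩ := exists_weights_of_mem_convexHull_range hF
  obtain ⟨h, hh0, hh1, hh⟩ := exists_weights_of_mem_convexHull_range hH
  have hne : f ≠ h := by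
    rintro rfl
    exact hFH (Measure.toSignedMeasure_eq_toSignedMeasure_iff.1 (hf.trans hh.symm))
  obtain ⟨g, γ, i, hg0, hg1, hγ, hfg, hgi, hhi⟩ := exists_residual_weights hf0 hf1 hh0 hh1 hne
  obtain ⟨G, hGprob, hG⟩ := exists_isProbabilityMeasure_toSignedMeasure_eq_sum P hg0 hg1
  refine ⟨G, hGprob, γ, hγ, ?_, fun hsub => ?_⟩
  · rw [hf, hG, hh, Finset.smul_sum, Finset.smul_sum, ← Finset.sum_add_distrib]
    exact Finset.sum_congr rfl fun j _ => by rw [hfg j, add_smul, mul_smul, mul_smul]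
  obtain ⟨x, hxi, hxj⟩ := Set.not_subset.1 (hsupp i)
  have hxH : x ∈ measureSupport H := by
    intro U hU hxU
    have hpos : 0 < (P i).real U := ENNReal.toReal_pos (hxi U hU hxU).ne' (measure_ne_top _ _)
    have hHU : 0 < H.real U := by
      rw [measureReal_eq_sum_of_toSignedMeasure_eq hh hU.measurableSet]
      exact (mul_pos hhi hpos).trans_le (Finset.single_le_sum
        (f := fun j => h j * (P j).real U)
        (fun j _ => mul_nonneg (hh0 j) measureReal_nonneg) (Finset.mem_univ i))
    exact (ENNReal.toReal_pos_iff.1 hHU).1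
  have hnull : ∀ j, ∃ U : Set X, IsOpen U ∧ x ∈ U ∧ (j ≠ i → P j U = 0) := by
    intro j
    by_cases hj : j = i
    · exact ⟨Set.univ, isOpen_univ, Set.mem_univ x, fun hji => (hji hj).elim⟩
    · have hx : x ∉ measureSupport (P j) := fun hx => hxj (Set.mem_biUnion (by simpa using hj) hx)
      simp only [measureSupport, Set.mem_ofPred_eq, not_forall, not_lt, nonpos_iff_eq_zero] at hx
      obtain ⟨U, hU, hxU, h0⟩ := hx
      exact ⟨U, hU, hxU, fun _ => h0⟩
  choose U hUo hxU hU0 using hnull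
  have hVo : IsOpen (⋂ j, U j) := isOpen_iInter_of_finite hUo
  refine (hsub hxH _ hVo (Set.mem_iInter.2 hxU)).ne' ?_
  rw [← measureReal_eq_zero_iff,
    measureReal_eq_sum_of_toSignedMeasure_eq hG hVo.measurableSet]
  refine Finset.sum_eq_zero fun j _ => ?_
  by_cases hj : j = i
  · rw [hj, hgi, zero_mul]
  · rw [measureReal_def, measure_mono_null (Set.iInter_subset U j) (hU0 j hj)]
    simp
end
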